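/- Let P be a self-adjoint bounded linear operator on L²(μ) mapping L²₀(μ) into itself that is positive, i.e. ⟨Pf, f⟩ ≥ 0 for all f ∈ L²(μ). Let Φ satisfy the stated conditions with constant a, and suppose that for all f ∈ L²₀(μ) and all s > 0 one has ‖f‖₂² ≤ s·⟨(I−P)f, f⟩ + β(s)·Φ(f), where β : (0,∞) → [0,∞) is decreasing with β(s) → 0 as s → ∞. Then for every f ∈ L²₀(μ) with 0 < Φ(f) < ∞ and every n ∈ ℕ, ‖Pⁿf‖₂² ≤ Φ(f)·F_a⁻¹(n). -/

import Mathlib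

open MeasureTheory Filter
open scoped RealInnerProductSpace
open scoped ENNReal

/-- `K(u) := u·β(1/u)` for `u ≠ 0`, with `K(0) := 0`. -/
noncomputable def Kfun (β : ℝ → ℝ) (u : ℝ) : ℝ := if u = 0 then 0 else u * β u⁻¹

/-- The convex conjugate `K*(v) := sup_{u ≥ 0} (u·v − K(u))`, valued in `[0,∞]`. -/
noncomputable def Kstar (β : ℝ → ℝ) (v : ℝ) : ℝ≥0∞ :=
  ⨆ u ∈ Set.Ici (0 : ℝ), ENNReal.ofReal (u * v - Kfun β u)

/-- `F_a(x) := ∫_x^a dv / K*(v)`. -/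
noncomputable def Fa (β : ℝ → ℝ) (a x : ℝ) : ℝ :=
  (∫⁻ v in Set.Ioc x a, (Kstar β v)⁻¹).toReal



theorem Kstar_mono (β : ℝ → ℝ) : Monotone (Kstar β) := by
  intro v w hvw
  refine iSup₂_mono fun u hu => ENNReal.ofReal_le_ofReal ?_
  have := mul_le_mul_of_nonneg_left hvw (Set.mem_Ici.mp hu)
  linarith

theorem Kstar_pos {β : ℝ → ℝ} (hβlim : Tendsto β atTop (nhds 0)) {v : ℝ} (hv : 0 < v) :
    0 < Kstar β v := by
  obtain ⟨s, hs, hs0⟩ := ((hβlim.eventually_lt_const hv).and (eventually_gt_atTop 0)).exists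
  have hs' : 0 < s⁻¹ := inv_pos.mpr hs0
  refine lt_of_lt_of_le ?_ (le_iSup₂ (f := fun u (_ : u ∈ Set.Ici (0 : ℝ)) =>
    ENNReal.ofReal (u * v - Kfun β u)) s⁻¹ hs'.le)
  rw [ENNReal.ofReal_pos, Kfun, if_neg hs'.ne', inv_inv, ← mul_sub]
  exact mul_pos hs' (sub_pos.mpr hs)

/-- Since `K*` is nondecreasing, `∫_x^y dv / K*(v) ≥ (y - x) / K*(y)`. -/
theorem inv_Kstar_mul_le_lintegral (β : ℝ → ℝ) (x y : ℝ) :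
    (Kstar β y)⁻¹ * ENNReal.ofReal (y - x) ≤ ∫⁻ v in Set.Ioc x y, (Kstar β v)⁻¹ := by
  rw [← Real.volume_Ioc, ← setLIntegral_const]
  exact setLIntegral_mono' measurableSet_Ioc fun v hv =>
    ENNReal.inv_le_inv.mpr (Kstar_mono β hv.2)

/-- A nonincreasing sequence with `v (k + 1) ≤ v k - K*(v k)` and `v 0 ≤ a` satisfies
`v n ≤ x` whenever `F_a(x) = n`. -/
theorem le_of_Kstar_le_sub {β : ℝ → ℝ} (hβlim : Tendsto β atTop (nhds 0)) {v : ℕ → ℝ}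
    (hv : Antitone v) (hK : ∀ k, Kstar β (v k) ≤ ENNReal.ofReal (v k - v (k + 1)))
    {a x : ℝ} (ha : v 0 ≤ a) (hx : 0 < x) {n : ℕ} (hn : 1 ≤ n) (hF : Fa β a x = n) :
    v n ≤ x := by
  by_contra! hlt
  have split {b c : ℝ} (hbc : b ≤ c) (hca : c ≤ a) :
      ∫⁻ w in Set.Ioc b a, (Kstar β w)⁻¹ =
        (∫⁻ w in Set.Ioc b c, (Kstar β w)⁻¹) + ∫⁻ w in Set.Ioc c a, (Kstar β w)⁻¹ := by
    rw [← Set.Ioc_union_Ioc_eq_Ioc hbc hca,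
      lintegral_union measurableSet_Ioc (Set.Ioc_disjoint_Ioc_of_le le_rfl)]
  have hva (k : ℕ) : v k ≤ a := (hv (Nat.zero_le k)).trans ha
  have hfin (k : ℕ) : Kstar β (v k) ≠ ∞ := ne_top_of_le_ne_top ENNReal.ofReal_ne_top (hK k)
  have hsum (k : ℕ) (hk : k ≤ n) : (k : ℝ≥0∞) ≤ ∫⁻ w in Set.Ioc (v k) a, (Kstar β w)⁻¹ := by
    induction k with
    | zero => simp
    | succ k ih =>
      rw [split (hv k.le_succ) (hva k), Nat.cast_succ, add_comm]
      refine add_le_add ?_ (ih (by omega))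
      have hpos : Kstar β (v k) ≠ 0 :=
        (Kstar_pos hβlim (hx.trans (hlt.trans_le (hv (by omega))))).ne'
      calc (1 : ℝ≥0∞) = (Kstar β (v k))⁻¹ * Kstar β (v k) :=
            (ENNReal.inv_mul_cancel hpos (hfin k)).symm
        _ ≤ (Kstar β (v k))⁻¹ * ENNReal.ofReal (v k - v (k + 1)) := by gcongr; exact hK k
        _ ≤ _ := inv_Kstar_mul_le_lintegral β _ _
  have hpos : 0 < ∫⁻ w in Set.Ioc x (v n), (Kstar β w)⁻¹ :=
    (ENNReal.mul_pos (ENNReal.inv_ne_zero.mpr (hfin n))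
      (ENNReal.ofReal_pos.mpr (sub_pos.mpr hlt)).ne').trans_le (inv_Kstar_mul_le_lintegral β _ _)
  have hF' : ∫⁻ w in Set.Ioc x a, (Kstar β w)⁻¹ = n := by
    have hne : (∫⁻ w in Set.Ioc x a, (Kstar β w)⁻¹) ≠ ∞ := by
      intro htop
      rw [Fa, htop, ENNReal.toReal_top] at hF
      exact (Nat.cast_ne_zero.mpr (by omega)) hF.symm
    rw [← ENNReal.ofReal_toReal hne, ← ENNReal.ofReal_natCast]
    exact congrArg ENNReal.ofReal hF
  have : (n : ℝ≥0∞) < n := calc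
    (n : ℝ≥0∞) < n + ∫⁻ w in Set.Ioc x (v n), (Kstar β w)⁻¹ :=
      ENNReal.lt_add_right (ENNReal.natCast_ne_top n) hpos.ne'
    _ ≤ ∫⁻ w in Set.Ioc x a, (Kstar β w)⁻¹ := by
      rw [split hlt.le (hva n), add_comm]
      gcongr
      exact hsum n le_rfl
    _ = n := hF'
  exact this.false

/-- If `P` is self-adjoint and positive and `⟪P (P f), P f⟫ ≤ ‖P f‖²`, then
`‖P f‖² ≤ ⟪P f, f⟫`. -/
theorem norm_sq_le_inner_of_positive {H : Type*} [NormedAddCommGroup H] [InnerProductSpace ℝ H]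
    {P : H →L[ℝ] H} (hsa : ∀ f g : H, ⟪P f, g⟫ = ⟪f, P g⟫) (hpos : ∀ f : H, 0 ≤ ⟪P f, f⟫)
    {f : H} (hf : 0 ≤ ⟪P f - P (P f), P f⟫) : ‖P f‖ ^ 2 ≤ ⟪P f, f⟫ := by
  have h := hpos (f - P f)
  rw [map_sub, inner_sub_left, inner_sub_right, inner_sub_right, hsa (P f) f] at h
  rw [inner_sub_left] at hf
  rw [← real_inner_self_eq_norm_sq]
  linarith

/-- The super-Poincaré inequality forces the Dirichlet form to be nonnegative. -/
theorem nonneg_of_le_mul_add {β : ℝ → ℝ} (hβlim : Tendsto β atTop (nhds 0)) {c q M : ℝ}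
    (hc : 0 ≤ c) (h : ∀ s : ℝ, 0 < s → c ≤ s * q + β s * M) : 0 ≤ q := by
  by_contra! hq
  have hlim : Tendsto (fun s => β s * M) atTop (nhds 0) := by simpa using hβlim.mul_const M
  have : -q ≤ 0 := by
    refine ge_of_tendsto hlim ?_
    filter_upwards [eventually_ge_atTop 1] with s hs
    nlinarith [h s (by linarith)]
  linarith

/-- Theorem (reversible positive case): if a self-adjoint positive `P` satisfies a
super-Poincaré inequality, then `‖Pⁿf‖₂² ≤ Φ(f)·F_a⁻¹(n)`. -/
theorem stmt7 {E : Type*} [MeasurableSpace E] (μ : Measure E) [IsProbabilityMeasure μ]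
    (P : Lp ℝ 2 μ →L[ℝ] Lp ℝ 2 μ)
    (hsa : ∀ f g : Lp ℝ 2 μ, ⟪P f, g⟫ = ⟪f, P g⟫)
    (hpos : ∀ f : Lp ℝ 2 μ, 0 ≤ ⟪P f, f⟫)
    (L20 : Set (Lp ℝ 2 μ)) (hL20 : L20 = {f : Lp ℝ 2 μ | ∫ x, f x ∂μ = 0})
    (hP0 : ∀ f ∈ L20, P f ∈ L20)
    (Φ : Lp ℝ 2 μ → ℝ≥0∞)
    (hΦhom : ∀ c : ℝ, 0 < c → ∀ f : Lp ℝ 2 μ, Φ (c • f) = ENNReal.ofReal (c ^ 2) * Φ f)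
    (hΦP : ∀ (n : ℕ) (f : Lp ℝ 2 μ), Φ ((P ^ n) f) ≤ Φ f)
    (a : ℝ) (ha : 0 < a)
    (hdom : ∀ f ∈ L20, Φ f ≠ ∞ → ‖f‖ ^ 2 ≤ a * (Φ f).toReal)
    (hleast : ∀ a' : ℝ, (∀ f ∈ L20, Φ f ≠ ∞ → ‖f‖ ^ 2 ≤ a' * (Φ f).toReal) → a ≤ a')
    (β : ℝ → ℝ) (hβ0 : ∀ s : ℝ, 0 < s → 0 ≤ β s)
    (hβdec : AntitoneOn β (Set.Ioi 0))
    (hβlim : Tendsto β atTop (nhds 0))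
    (hSPI : ∀ f ∈ L20, Φ f ≠ ∞ → ∀ s : ℝ, 0 < s →
      ‖f‖ ^ 2 ≤ s * ⟪f - P f, f⟫ + β s * (Φ f).toReal)
    (Finv : ℝ → ℝ)
    (hFinv : ∀ x : ℝ, 0 < x → Finv x ∈ Set.Ioo 0 a ∧ Fa β a (Finv x) = x) :
    ∀ f ∈ L20, Φ f ≠ 0 → Φ f ≠ ∞ → ∀ n : ℕ, 1 ≤ n →
      ‖(P ^ n) f‖ ^ 2 ≤ (Φ f).toReal * Finv (n : ℝ) := by
  intro f hf hf0 hft n hn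
  have hM : 0 < (Φ f).toReal := ENNReal.toReal_pos hf0 hft
  set M := (Φ f).toReal
  have hmem (k : ℕ) : (P ^ k) f ∈ L20 := by
    induction k with
    | zero => simpa using hf
    | succ k ih => rw [pow_succ']; exact hP0 _ ih
  have hSPI' (k : ℕ) (s : ℝ) (hs : 0 < s) :
      ‖(P ^ k) f‖ ^ 2 ≤ s * ⟪(P ^ k) f - P ((P ^ k) f), (P ^ k) f⟫ + β s * M :=
    (hSPI _ (hmem k) (ne_top_of_le_ne_top hft (hΦP k f)) s hs).trans <| by
      have := mul_le_mul_of_nonneg_left (ENNReal.toReal_mono hft (hΦP k f)) (hβ0 s hs)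
      linarith
  have hDnonneg (k : ℕ) : 0 ≤ ⟪(P ^ k) f - P ((P ^ k) f), (P ^ k) f⟫ :=
    nonneg_of_le_mul_add hβlim (sq_nonneg _) (hSPI' k)
  have hstep (k : ℕ) : ⟪(P ^ k) f - P ((P ^ k) f), (P ^ k) f⟫ ≤
      ‖(P ^ k) f‖ ^ 2 - ‖(P ^ (k + 1)) f‖ ^ 2 := by
    have h := hDnonneg (k + 1)
    have hP : (P ^ (k + 1)) f = P ((P ^ k) f) := by rw [pow_succ']; rfl
    rw [hP] at h ⊢
    have := norm_sq_le_inner_of_positive hsa hpos h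
    rw [inner_sub_left, real_inner_self_eq_norm_sq]
    exact sub_le_sub_left this _
  have key : ‖(P ^ n) f‖ ^ 2 / M ≤ Finv n := by
    obtain ⟨hx, hF⟩ := hFinv n (by exact_mod_cast hn)
    refine le_of_Kstar_le_sub (v := fun k => ‖(P ^ k) f‖ ^ 2 / M) hβlim
      (antitone_nat_of_succ_le fun k => ?_) (fun k => ?_) ?_ hx.1 hn hF
    · gcongr ?_ / M
      linarith [hDnonneg k, hstep k]
    · refine iSup₂_le fun u hu => ENNReal.ofReal_le_ofReal ?_
      rw [← sub_div, le_div_iff₀ hM]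
      refine le_trans ?_ (hstep k)
      rcases (Set.mem_Ici.mp hu).eq_or_lt with rfl | hu
      · simpa [Kfun] using hDnonneg k
      · rw [Kfun, if_neg hu.ne']
        have h := mul_le_mul_of_nonneg_left (hSPI' k u⁻¹ (inv_pos.mpr hu)) hu.le
        rw [mul_add, mul_inv_cancel_left₀ hu.ne'] at h
        rw [sub_mul, mul_assoc, div_mul_cancel₀ _ hM.ne']
        linarith
    · rw [div_le_iff₀ hM]
      simpa using hdom f hf hft
  rwa [div_le_iff₀' hM] at key
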